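/- In the warden's game with n dice each having m sides (m ≥ 1, n ≥ 1), the remoteness function r is a bijection from the set of all positions (Fin m)^n onto the set {0, 1, …, m^n − 1}; in particular, no two distinct positions have the same remoteness. -/

import Mathlib

/-- One move: the rightmost entry is transferred to the far left, becoming `c`,
producing `(c, x₀, …, x_{n−2})`. -/
def shift {α : Type*} {n : ℕ} (c : α) (x : Fin n → α) : Fin n → α :=
  fun i => if _h : (i : ℕ) = 0 then c
    else x ⟨(i : ℕ) - 1, lt_of_le_of_lt (Nat.sub_le _ _) i.isLt⟩

/-- The goal position: every die shows `m - 1`. -/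
def goalPos (m n : ℕ) (hm : 1 ≤ m) : Fin n → Fin m :=
  fun _ => ⟨m - 1, Nat.sub_lt hm Nat.one_pos⟩

/-- `CanWin m n hm hn N x`: the prisoner can force the goal within `N` moves from
position `x`.  It holds iff `x` is the goal, or `N ≥ 1` and both:
(i) for every warden choice `c < x_{n-1}`, `CanWin (N-1)` holds at `(c, x₀, …, x_{n−2})`, and
(ii) there is a prisoner choice `c ≥ x_{n-1}` with `CanWin (N-1)` at `(c, x₀, …, x_{n−2})`. -/
def CanWin (m n : ℕ) (hm : 1 ≤ m) (hn : 1 ≤ n) : ℕ → (Fin n → Fin m) → Prop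
  | 0, x => x = goalPos m n hm
  | N + 1, x => x = goalPos m n hm ∨
      ((∀ c : Fin m, c < x ⟨n - 1, Nat.sub_lt hn Nat.one_pos⟩ →
          CanWin m n hm hn N (shift c x)) ∧
       ∃ c : Fin m, x ⟨n - 1, Nat.sub_lt hn Nat.one_pos⟩ ≤ c ∧
          CanWin m n hm hn N (shift c x))

/-- The remoteness of a position: the least `N` with `CanWin N x`. -/
noncomputable def remoteness (m n : ℕ) (hm : 1 ≤ m) (hn : 1 ≤ n)
    (x : Fin n → Fin m) : ℕ :=
  sInf {N | CanWin m n hm hn N x}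

theorem shift_apply_of_val_eq_zero {α : Type*} {n : ℕ} (c : α) (x : Fin n → α) (i : Fin n)
    (hi : (i : ℕ) = 0) : shift c x i = c := by
  simp [shift, hi]

theorem shift_apply_of_val_eq_succ {α : Type*} {n : ℕ} (c : α) (x : Fin n → α) (i j : Fin n)
    (hij : (i : ℕ) = j + 1) : shift c x i = x j := by
  have hi : (i : ℕ) ≠ 0 := by omega
  have hj : (⟨(i : ℕ) - 1, lt_of_le_of_lt (Nat.sub_le _ _) i.isLt⟩ : Fin n) = j :=
    Fin.ext (by simp; omega)
  simp [shift, hi, hj]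

/-- Reading off the two ends, a position is determined by its shift and its last entry. -/
theorem eq_of_shift_eq_shift {α : Type*} {n : ℕ} (hn : 1 ≤ n) {c d : α} {x y : Fin n → α}
    (h : shift c x = shift d y)
    (hlast : x ⟨n - 1, Nat.sub_lt hn Nat.one_pos⟩ = y ⟨n - 1, Nat.sub_lt hn Nat.one_pos⟩) :
    x = y := by
  funext i
  by_cases hi : (i : ℕ) + 1 < n
  · have h' := congrFun h ⟨i + 1, hi⟩
    rwa [shift_apply_of_val_eq_succ c x _ i rfl, shift_apply_of_val_eq_succ d y _ i rfl] at h'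
  · have : i = ⟨n - 1, Nat.sub_lt hn Nat.one_pos⟩ := Fin.ext (by simp; omega)
    rw [this, hlast]

theorem head_eq_of_shift_eq_shift {α : Type*} {n : ℕ} (hn : 1 ≤ n) {c d : α} {x y : Fin n → α}
    (h : shift c x = shift d y) : c = d := by
  have h' := congrFun h ⟨0, hn⟩
  rwa [shift_apply_of_val_eq_zero _ _ _ rfl, shift_apply_of_val_eq_zero _ _ _ rfl] at h'

/-- A set of positions that contains the goal and every position from which the prisoner can
force the next position into the set consists of all positions.  A lexicographically least position
outside it would be beaten by the prisoner who plays `m - 1` until the warden first interferes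
and repeats the last entry from then on. -/
theorem mem_of_goalPos_mem_of_forced {m n : ℕ} (hm : 1 ≤ m) (hn : 1 ≤ n)
    (S : Set (Fin n → Fin m)) (hg : goalPos m n hm ∈ S)
    (hS : ∀ x : Fin n → Fin m,
      (∀ c, c < x ⟨n - 1, Nat.sub_lt hn Nat.one_pos⟩ → shift c x ∈ S) →
      (∃ c, x ⟨n - 1, Nat.sub_lt hn Nat.one_pos⟩ ≤ c ∧ shift c x ∈ S) → x ∈ S)
    (x : Fin n → Fin m) : x ∈ S := by
  by_contra hx
  obtain ⟨x, hx, hmin⟩ : ∃ x : Fin n → Fin m, x ∉ S ∧ ∀ z, z ∉ S → toLex x ≤ toLex z :=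
    Set.exists_min_image Sᶜ toLex (Set.toFinite _) ⟨x, hx⟩
  have key : ∀ j ≤ n, ∃ z : Fin n → Fin m, z ∉ S ∧
      (∀ i i' : Fin n, (i : ℕ) = i' + j → z i = x i') ∧
      ((∀ i : Fin n, (i : ℕ) < j → z i = ⟨m - 1, Nat.sub_lt hm Nat.one_pos⟩) ∨
        ∃ k k' : Fin n, (k' : ℕ) + j = n + k ∧ z k < x k' ∧
          ∀ i i' : Fin n, i < k → (i' : ℕ) + j = n + i → z i ≤ x i') := by
    intro j
    induction j with
    | zero =>
      intro _
      refine ⟨x, hx, fun i i' h => ?_, Or.inl fun i h => absurd h (Nat.not_lt_zero _)⟩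
      rw [Fin.ext h]
    | succ j ih =>
      intro hj
      obtain ⟨z, hz, hold, hnew⟩ := ih (by omega)
      have hlast : z ⟨n - 1, Nat.sub_lt hn Nat.one_pos⟩ = x ⟨n - 1 - j, by omega⟩ :=
        hold _ _ (by simp; omega)
      have hold' : ∀ c, ∀ i i' : Fin n, (i : ℕ) = i' + (j + 1) → shift c z i = x i' := by
        intro c i i' h
        rw [shift_apply_of_val_eq_succ c z i ⟨i' + j, by omega⟩ (by simp; omega)]
        exact hold _ _ rfl
      by_cases hw : ∃ c, c < z ⟨n - 1, Nat.sub_lt hn Nat.one_pos⟩ ∧ shift c z ∉ S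
      · obtain ⟨c, hc, hcS⟩ := hw
        refine ⟨shift c z, hcS, hold' c,
          Or.inr ⟨⟨0, hn⟩, ⟨n - 1 - j, by omega⟩, by simp; omega, ?_, ?_⟩⟩
        · rwa [shift_apply_of_val_eq_zero _ _ _ rfl, ← hlast]
        · intro i i' hi
          exact absurd hi (Nat.not_lt_zero _)
      · push Not at hw
        have hp : ∀ c, z ⟨n - 1, Nat.sub_lt hn Nat.one_pos⟩ ≤ c → shift c z ∉ S :=
          fun c hc hcS => hz (hS z hw ⟨c, hc, hcS⟩)
        rcases hnew with htop | ⟨k, k', hk, hlt, hle⟩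
        · refine ⟨_, hp ⟨m - 1, Nat.sub_lt hm Nat.one_pos⟩ ?_, hold' _, Or.inl fun i hi => ?_⟩
          · rw [Fin.le_def]
            simp only
            omega
          · by_cases hi0 : (i : ℕ) = 0
            · exact shift_apply_of_val_eq_zero _ _ _ hi0
            · rw [shift_apply_of_val_eq_succ _ z i ⟨i - 1, by omega⟩ (by simp; omega)]
              exact htop _ (by simp; omega)
        · refine ⟨_, hp _ le_rfl, hold' _,
            Or.inr ⟨⟨k + 1, by omega⟩, k', by simp; omega, ?_, fun i i' hi hi' => ?_⟩⟩
          · rwa [shift_apply_of_val_eq_succ _ z _ k rfl]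
          · by_cases hi0 : (i : ℕ) = 0
            · rw [shift_apply_of_val_eq_zero _ _ _ hi0, hlast]
              exact le_of_eq (congrArg x (Fin.ext (by simp; omega)))
            · rw [Fin.lt_def] at hi
              simp only at hi
              rw [shift_apply_of_val_eq_succ _ z i ⟨i - 1, by omega⟩ (by simp; omega)]
              exact hle _ _ (Fin.lt_def.2 (by simp; omega)) (by simp; omega)
  obtain ⟨z, hz, -, htop | ⟨k, k', hk, hlt, hle⟩⟩ := key n le_rfl
  · exact hz ((funext fun i => htop i i.isLt : z = goalPos m n hm) ▸ hg)
  · obtain rfl : k' = k := Fin.ext (by omega)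
    refine (hmin z hz).not_gt ?_
    have hlez : ∀ i < k', z i ≤ x i := fun i hi => hle i i hi (by omega)
    by_cases heq : ∀ i < k', z i = x i
    · exact ⟨k', heq, hlt⟩
    · push Not at heq
      obtain ⟨i, ⟨hi, hne⟩, hfirst⟩ :=
        Set.exists_min_image {i | i < k' ∧ z i ≠ x i} id (Set.toFinite _) heq
      refine ⟨i, fun l hl => ?_, lt_of_le_of_ne (hlez i hi) hne⟩
      by_contra hl'
      exact (hfirst l ⟨hl.trans hi, hl'⟩).not_gt hl

theorem canWin_goalPos {m n : ℕ} (hm : 1 ≤ m) (hn : 1 ≤ n) (N : ℕ) :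
    CanWin m n hm hn N (goalPos m n hm) := by
  cases N with
  | zero => rfl
  | succ N => exact Or.inl rfl

theorem CanWin.succ {m n : ℕ} {hm : 1 ≤ m} {hn : 1 ≤ n} {N : ℕ} {x : Fin n → Fin m}
    (h : CanWin m n hm hn N x) : CanWin m n hm hn (N + 1) x := by
  induction N generalizing x with
  | zero => exact Or.inl h
  | succ N ih =>
    rcases h with h | ⟨h₁, c, hc, h₂⟩
    · exact Or.inl h
    · exact Or.inr ⟨fun c hc => ih (h₁ c hc), c, hc, ih h₂⟩

theorem CanWin.mono {m n : ℕ} {hm : 1 ≤ m} {hn : 1 ≤ n} {N M : ℕ} {x : Fin n → Fin m}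
    (h : CanWin m n hm hn N x) (hNM : N ≤ M) : CanWin m n hm hn M x := by
  induction hNM with
  | refl => exact h
  | step _ ih => exact ih.succ

/-- Allowing one more move adds at most one winning position. -/
theorem ncard_canWin_succ_le {m n : ℕ} (hm : 1 ≤ m) (hn : 1 ≤ n) (N : ℕ) :
    {x | CanWin m n hm hn (N + 1) x}.ncard ≤ {x | CanWin m n hm hn N x}.ncard + 1 := by
  have hreply : ∀ x, ∃ c : Fin m, CanWin m n hm hn (N + 1) x → x ≠ goalPos m n hm →
      x ⟨n - 1, Nat.sub_lt hn Nat.one_pos⟩ ≤ c ∧ CanWin m n hm hn N (shift c x) ∧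
      (CanWin m n hm hn N (shift (x ⟨n - 1, Nat.sub_lt hn Nat.one_pos⟩) x) →
        c = x ⟨n - 1, Nat.sub_lt hn Nat.one_pos⟩) := by
    intro x
    by_cases ha : CanWin m n hm hn N (shift (x ⟨n - 1, Nat.sub_lt hn Nat.one_pos⟩) x)
    · exact ⟨_, fun _ _ => ⟨le_rfl, ha, fun _ => rfl⟩⟩
    · by_cases hx : CanWin m n hm hn (N + 1) x ∧ x ≠ goalPos m n hm
      · obtain ⟨hx | ⟨-, c, hc, hcw⟩, hne⟩ := hx
        · exact absurd hx hne
        · exact ⟨c, fun _ _ => ⟨hc, hcw, fun h => absurd h ha⟩⟩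
      · exact ⟨⟨0, hm⟩, fun h₁ h₂ => absurd ⟨h₁, h₂⟩ hx⟩
  choose φ hφ using hreply
  have hle : ∀ x y, CanWin m n hm hn (N + 1) x → x ≠ goalPos m n hm →
      CanWin m n hm hn (N + 1) y → y ≠ goalPos m n hm → shift (φ x) x = shift (φ y) y →
      y ⟨n - 1, Nat.sub_lt hn Nat.one_pos⟩ ≤ x ⟨n - 1, Nat.sub_lt hn Nat.one_pos⟩ := by
    intro x y hx hxg hy hyg h
    by_contra! hlt
    have hhead : φ x = φ y := head_eq_of_shift_eq_shift hn h
    have hsh : ∀ c, shift c x = shift c y := by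
      intro c
      funext i
      by_cases hi : (i : ℕ) = 0
      · rw [shift_apply_of_val_eq_zero _ _ _ hi, shift_apply_of_val_eq_zero _ _ _ hi]
      · have h' := congrFun h i
        have hi' : (i : ℕ) = (⟨i - 1, by omega⟩ : Fin n) + 1 := by simp; omega
        rwa [shift_apply_of_val_eq_succ _ _ _ _ hi', shift_apply_of_val_eq_succ _ _ _ _ hi']
          at h' ⊢
    obtain ⟨-, -, h₁⟩ := hφ x hx hxg
    obtain ⟨h₂, -, -⟩ := hφ y hy hyg
    rcases hy with hy | ⟨hy, -⟩
    · exact hyg hy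
    · have := h₁ (by rw [hsh]; exact hy _ hlt)
      rw [← hhead, this] at h₂
      exact h₂.not_gt hlt
  have hsub : ({x | CanWin m n hm hn (N + 1) x} \ {goalPos m n hm}).ncard ≤
      {x | CanWin m n hm hn N x}.ncard := by
    refine Set.ncard_le_ncard_of_injOn (fun x => shift (φ x) x)
      (fun x hx => (hφ x hx.1 hx.2).2.1) ?_ (Set.toFinite _)
    intro x hx y hy h
    exact eq_of_shift_eq_shift hn h
      (le_antisymm (hle y x hy.1 hy.2 hx.1 hx.2 h.symm) (hle x y hx.1 hx.2 hy.1 hy.2 h))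
  have := Set.ncard_sdiff_singleton_add_one (s := {x | CanWin m n hm hn (N + 1) x})
    (a := goalPos m n hm) (canWin_goalPos hm hn _) (Set.toFinite _)
  omega

theorem ncard_canWin_le {m n : ℕ} (hm : 1 ≤ m) (hn : 1 ≤ n) (N : ℕ) :
    {x | CanWin m n hm hn N x}.ncard ≤ N + 1 := by
  induction N with
  | zero => exact (Set.ncard_singleton (goalPos m n hm)).le
  | succ N ih => exact (ncard_canWin_succ_le hm hn N).trans (Nat.succ_le_succ ih)

/-- Unless every position is winning within `N` moves, one more move makes a new one winning. -/
theorem exists_canWin_succ_not_canWin {m n : ℕ} (hm : 1 ≤ m) (hn : 1 ≤ n) (N : ℕ)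
    (h : ∃ x, ¬ CanWin m n hm hn N x) :
    ∃ x, CanWin m n hm hn (N + 1) x ∧ ¬ CanWin m n hm hn N x := by
  by_contra! hstable
  obtain ⟨x, hx⟩ := h
  exact hx (mem_of_goalPos_mem_of_forced hm hn {x | CanWin m n hm hn N x}
    (canWin_goalPos hm hn N) (fun y h₁ h₂ => hstable y (Or.inr ⟨h₁, h₂⟩)) x)

theorem le_ncard_canWin {m n : ℕ} (hm : 1 ≤ m) (hn : 1 ≤ n) (N : ℕ) (hN : N < m ^ n) :
    N + 1 ≤ {x | CanWin m n hm hn N x}.ncard := by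
  induction N with
  | zero => exact (Set.ncard_singleton (goalPos m n hm)).ge
  | succ N ih =>
    have hlt : {x | CanWin m n hm hn N x}.ncard < {x | CanWin m n hm hn (N + 1) x}.ncard := by
      refine Set.ncard_lt_ncard ⟨fun x hx => CanWin.succ hx, fun hsub => ?_⟩ (Set.toFinite _)
      have hall : ∀ x, CanWin m n hm hn N x := by
        by_contra! h
        obtain ⟨x, h₁, h₂⟩ := exists_canWin_succ_not_canWin hm hn N h
        exact h₂ (hsub h₁)
      have hcard := ncard_canWin_le hm hn N
      rw [Set.eq_univ_of_forall (s := {x | CanWin m n hm hn N x}) hall, Set.ncard_univ] at hcard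
      simp at hcard
      omega
    have := ih (by omega)
    omega

theorem canWin_pow_sub_one {m n : ℕ} (hm : 1 ≤ m) (hn : 1 ≤ n) (x : Fin n → Fin m) :
    CanWin m n hm hn (m ^ n - 1) x := by
  have hpos : 0 < m ^ n := Nat.pow_pos hm
  have hcard := le_ncard_canWin hm hn (m ^ n - 1) (by omega)
  have huniv : {x | CanWin m n hm hn (m ^ n - 1) x} = Set.univ :=
    Set.eq_of_subset_of_ncard_le (Set.subset_univ _)
      (by rw [Set.ncard_univ]; simp; omega) (Set.toFinite _)
  exact Set.eq_univ_iff_forall.1 huniv x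

/-- **The Game Tree is a Single Chain.** The remoteness function is a bijection
from the set of all positions onto `{0, 1, …, m ^ n − 1}`; in particular no two
distinct positions have the same remoteness. -/
theorem remoteness_bijOn (m n : ℕ) (hm : 1 ≤ m) (hn : 1 ≤ n) :
    Set.BijOn (remoteness m n hm hn) Set.univ (Set.Iio (m ^ n)) := by
  have hpos : 0 < m ^ n := Nat.pow_pos hm
  have hmaps : Set.MapsTo (remoteness m n hm hn) Set.univ (Set.Iio (m ^ n)) := fun x _ =>
    (Nat.sInf_le (canWin_pow_sub_one hm hn x)).trans_lt (by omega)
  have hsurj : Set.SurjOn (remoteness m n hm hn) Set.univ (Set.Iio (m ^ n)) := by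
    intro N hN
    rw [Set.mem_Iio] at hN
    cases N with
    | zero =>
      exact ⟨goalPos m n hm, Set.mem_univ _,
        Nat.le_zero.1 (Nat.sInf_le (canWin_goalPos hm hn 0))⟩
    | succ N =>
      have hnot : ∃ x, ¬ CanWin m n hm hn N x := by
        by_contra! hall
        have hcard := ncard_canWin_le hm hn N
        rw [Set.eq_univ_of_forall (s := {x | CanWin m n hm hn N x}) hall, Set.ncard_univ] at hcard
        simp at hcard
        omega
      obtain ⟨x, h₁, h₂⟩ := exists_canWin_succ_not_canWin hm hn N hnot
      refine ⟨x, Set.mem_univ _, le_antisymm (Nat.sInf_le h₁) ?_⟩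
      by_contra! hlt
      have hmem : CanWin m n hm hn (remoteness m n hm hn x) x :=
        Nat.sInf_mem (s := {N | CanWin m n hm hn N x}) ⟨N + 1, h₁⟩
      exact h₂ (hmem.mono (Nat.lt_succ_iff.1 hlt))
  refine ⟨hmaps, ?_, hsurj⟩
  refine Set.injOn_of_ncard_image_eq ?_ (Set.toFinite _)
  rw [hsurj.image_eq_of_mapsTo hmaps, Set.ncard_univ, Set.ncard_eq_toFinset_card']
  simp
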